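/- arXiv:1411.0290 — 4 statements merged into one kernel-verified Lean document; each statement's English description precedes it below -/
import Mathlib

section
/- For the complete bipartite graph K_{m,n}: if min{m,n} = 1, then w_c(K_{m,n}) = W_c(K_{m,n}) = m + n − 1; if min{m,n} ≥ 2, then w_c(K_{m,n}) = max{m,n} and W_c(K_{m,n}) ≥ m + n. -/
attribute [local instance] Classical.propDecidable

namespace IntervalCyclic

variable {V : Type*}

/-- An interval cyclic `t`-coloring: a proper edge-coloring with colors viewed as
elements of `ZMod t` (representing the colors `1,…,t` cyclically) such that all `t`
colors are used and, at every vertex `v`, the set of colors on the edges incident to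
`v` is a set of `d_G(v)` consecutive colors modulo `t`. -/
def IsIntervalCyclicColoring [Fintype V] (G : SimpleGraph V) (t : ℕ)
    (c : Sym2 V → ZMod t) : Prop :=
  (∀ v w w' : V, G.Adj v w → G.Adj v w' → w ≠ w' → c s(v, w) ≠ c s(v, w')) ∧
  (∀ x : ZMod t, ∃ e ∈ G.edgeSet, c e = x) ∧
  (∀ v : V, ∃ k : ZMod t,
    (G.neighborFinset v).image (fun w => c s(v, w)) =
      (Finset.range (G.degree v)).image (fun i => k + (i : ZMod t)))

/-- `G` has an interval cyclic `t`-coloring for the positive integer `t`. -/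
def HasIntervalCyclicColoring [Fintype V] (G : SimpleGraph V) (t : ℕ) : Prop :=
  0 < t ∧ ∃ c : Sym2 V → ZMod t, IsIntervalCyclicColoring G t c

/-- The greatest `t` for which `G` has an interval cyclic `t`-coloring. -/
noncomputable def Wc [Fintype V] (G : SimpleGraph V) : ℕ :=
  sSup {t | HasIntervalCyclicColoring G t}

/-- The least `t` for which `G` has an interval cyclic `t`-coloring. -/
noncomputable def wc [Fintype V] (G : SimpleGraph V) : ℕ :=
  sInf {t | HasIntervalCyclicColoring G t}

lemma isIntervalCyclicColoring_of_mem [Fintype V] {G : SimpleGraph V} {t : ℕ} {c : Sym2 V → ZMod t}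
    (hproper : ∀ v w w' : V, G.Adj v w → G.Adj v w' → w ≠ w' → c s(v, w) ≠ c s(v, w'))
    (hsurj : ∀ x : ZMod t, ∃ e ∈ G.edgeSet, c e = x)
    (hinterval : ∀ v : V, ∃ k : ZMod t, ∀ w, G.Adj v w → ∃ l < G.degree v, c s(v, w) = k + (l : ZMod t)) :
    IsIntervalCyclicColoring G t c := by
  refine ⟨hproper, hsurj, fun v => ?_⟩
  obtain ⟨k, hk⟩ := hinterval v
  have hbind : (do let a ← Finset.range (G.degree v); pure (a : ZMod t) : Finset (ZMod t)) =
      (Finset.range (G.degree v)).image (fun a : ℕ => (a : ZMod t)) := by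
    ext x
    simp [eq_comm]
  refine ⟨k, ?_⟩
  rw [hbind, Finset.image_image]
  refine Finset.eq_of_subset_of_card_le ?_ ?_
  · intro x hx
    obtain ⟨w, hw, rfl⟩ := Finset.mem_image.1 hx
    obtain ⟨l, hl, h⟩ := hk w (by simpa using hw)
    exact Finset.mem_image.2 ⟨l, Finset.mem_range.2 hl, h.symm⟩
  · refine Finset.card_image_le.trans ?_
    rw [Finset.card_range, Finset.card_image_of_injOn, G.card_neighborFinset_eq_degree]
    intro w hw w' hw' h
    by_contra hne
    exact hproper v w w' (by simpa using hw) (by simpa using hw') hne h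

lemma HasIntervalCyclicColoring.degree_le [Fintype V] {G : SimpleGraph V} {t : ℕ}
    (h : HasIntervalCyclicColoring G t) (v : V) : G.degree v ≤ t := by
  obtain ⟨ht, c, hproper, -, -⟩ := h
  have : NeZero t := ⟨ht.ne'⟩
  rw [← G.card_neighborFinset_eq_degree, ← ZMod.card t, ← Finset.card_univ]
  refine Finset.card_le_card_of_injOn (fun w => c s(v, w)) (fun _ _ => Finset.mem_univ _) ?_
  intro w hw w' hw' h
  by_contra hne
  exact hproper v w w' (by simpa using hw) (by simpa using hw') hne h

lemma degree_completeBipartiteGraph_inl {m n : ℕ} (i : Fin m) :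
    (completeBipartiteGraph (Fin m) (Fin n)).degree (Sum.inl i) = n := by
  rw [← SimpleGraph.card_neighborFinset_eq_degree]
  have : (completeBipartiteGraph (Fin m) (Fin n)).neighborFinset (Sum.inl i) =
      Finset.univ.map Function.Embedding.inr := by
    ext (w | w) <;> simp
  simp [this]

lemma degree_completeBipartiteGraph_inr {m n : ℕ} (j : Fin n) :
    (completeBipartiteGraph (Fin m) (Fin n)).degree (Sum.inr j) = m := by
  rw [← SimpleGraph.card_neighborFinset_eq_degree]
  have : (completeBipartiteGraph (Fin m) (Fin n)).neighborFinset (Sum.inr j) =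
      Finset.univ.map Function.Embedding.inl := by
    ext (w | w) <;> simp
  simp [this]

lemma HasIntervalCyclicColoring.le_mul {m n t : ℕ}
    (h : HasIntervalCyclicColoring (completeBipartiteGraph (Fin m) (Fin n)) t) : t ≤ m * n := by
  obtain ⟨ht, c, -, hsurj, -⟩ := h
  have : NeZero t := ⟨ht.ne'⟩
  have hs : Function.Surjective
      (fun p : Fin m × Fin n => c s(Sum.inl p.1, Sum.inr p.2)) := by
    intro x
    obtain ⟨e, he, rfl⟩ := hsurj x
    induction e using Sym2.ind with
    | _ v w =>
      rcases v with i | j <;> rcases w with i' | j' <;> simp at he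
      · exact ⟨(i, j'), rfl⟩
      · exact ⟨(i', j), by simp [Sym2.eq_swap]⟩
  simpa using Fintype.card_le_of_surjective _ hs

lemma HasIntervalCyclicColoring.max_le {m n t : ℕ} (hm : 0 < m) (hn : 0 < n)
    (h : HasIntervalCyclicColoring (completeBipartiteGraph (Fin m) (Fin n)) t) :
    max m n ≤ t := by
  have h₁ := h.degree_le (Sum.inl ⟨0, hm⟩)
  have h₂ := h.degree_le (Sum.inr ⟨0, hn⟩)
  rw [degree_completeBipartiteGraph_inl] at h₁
  rw [degree_completeBipartiteGraph_inr] at h₂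
  exact Nat.max_le.2 ⟨h₂, h₁⟩

/-- The colors of the edges of `K_{m,n}` given by an `m × n` array; other pairs get color `0`. -/
def arrayColor {m n t : ℕ} (f : Fin m → Fin n → ZMod t) :
    Sym2 (Fin m ⊕ Fin n) → ZMod t :=
  Sym2.lift ⟨fun
    | .inl i, .inr j => f i j
    | .inr j, .inl i => f i j
    | .inl _, .inl _ => 0
    | .inr _, .inr _ => 0, by rintro (_ | _) (_ | _) <;> rfl⟩

lemma hasIntervalCyclicColoring_of_array {m n t : ℕ} (ht : 0 < t) (f : Fin m → Fin n → ZMod t)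
    (hrow : ∀ i, Function.Injective (f i)) (hcol : ∀ j, Function.Injective fun i => f i j)
    (hsurj : ∀ x, ∃ i j, f i j = x)
    (hrow_int : ∀ i, ∃ k : ZMod t, ∀ j, ∃ l < n, f i j = k + (l : ZMod t))
    (hcol_int : ∀ j, ∃ k : ZMod t, ∀ i, ∃ l < m, f i j = k + (l : ZMod t)) :
    HasIntervalCyclicColoring (completeBipartiteGraph (Fin m) (Fin n)) t := by
  refine ⟨ht, arrayColor f, isIntervalCyclicColoring_of_mem ?_ ?_ ?_⟩
  · rintro (i | j) (w | w) (w' | w') h h' hne <;> simp at h h'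
    · exact fun e => hne (congrArg _ (hrow i e))
    · exact fun e => hne (congrArg _ (hcol j e))
  · intro x
    obtain ⟨i, j, rfl⟩ := hsurj x
    exact ⟨s(Sum.inl i, Sum.inr j), by simp, rfl⟩
  · rintro (i | j)
    · obtain ⟨k, hk⟩ := hrow_int i
      refine ⟨k, ?_⟩
      rw [degree_completeBipartiteGraph_inl]
      rintro (w | w) h
      · simp at h
      · exact hk w
    · obtain ⟨k, hk⟩ := hcol_int j
      refine ⟨k, ?_⟩
      rw [degree_completeBipartiteGraph_inr]
      rintro (w | w) h
      · exact hk w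
      · simp at h

lemma natCast_zmod_inj {t a b : ℕ} (ha : a < t) (hb : b < t) (h : (a : ZMod t) = b) : a = b := by
  rw [ZMod.natCast_eq_natCast_iff] at h
  exact h.eq_of_lt_of_lt ha hb

lemma hasIntervalCyclicColoring_max {m n : ℕ} (hm : 0 < m) (hn : 0 < n) :
    HasIntervalCyclicColoring (completeBipartiteGraph (Fin m) (Fin n)) (max m n) := by
  have : NeZero (max m n) := ⟨by omega⟩
  refine hasIntervalCyclicColoring_of_array (by omega)
    (fun i j => ((i : ℕ) : ZMod (max m n)) + ((j : ℕ) : ZMod (max m n))) ?_ ?_ ?_ ?_ ?_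
  · intro i j j' h
    exact Fin.ext (natCast_zmod_inj (by omega) (by omega) (add_left_cancel h))
  · intro j i i' h
    exact Fin.ext (natCast_zmod_inj (by omega) (by omega) (add_right_cancel h))
  · intro x
    have hx := x.val_lt
    rcases lt_max_iff.1 hx with h | h
    · exact ⟨⟨x.val, h⟩, ⟨0, hn⟩, by simp⟩
    · exact ⟨⟨0, hm⟩, ⟨x.val, h⟩, by simp⟩
  · exact fun i => ⟨_, fun j => ⟨j, j.2, rfl⟩⟩
  · exact fun j => ⟨_, fun i => ⟨i, i.2, add_comm _ _⟩⟩

lemma hasIntervalCyclicColoring_add {m n : ℕ} (hm : 2 ≤ m) (hn : 2 ≤ n) :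
    HasIntervalCyclicColoring (completeBipartiteGraph (Fin m) (Fin n)) (m + n) := by
  have : NeZero (m + n) := ⟨by omega⟩
  let a (i j : ℕ) : ℕ := if i = m - 1 ∧ j = 0 then m + n - 1 else i + j
  have ha (i : Fin m) (j : Fin n) : a i j < m + n := by grind
  refine hasIntervalCyclicColoring_of_array (by omega)
    (fun i j => (a i j : ZMod (m + n))) ?_ ?_ ?_ ?_ ?_
  · intro i j j' h
    have := natCast_zmod_inj (ha i j) (ha i j') h
    grind
  · intro j i i' h
    have := natCast_zmod_inj (ha i j) (ha i' j) h
    grind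
  · intro x
    have hx := x.val_lt
    suffices h : ∃ (i : Fin m) (j : Fin n), a i j = x.val by
      obtain ⟨i, j, h⟩ := h
      exact ⟨i, j, by simp [h]⟩
    rcases lt_or_ge x.val (m - 1) with h | h
    · exact ⟨⟨x.val, by omega⟩, ⟨0, by omega⟩, by grind⟩
    rcases lt_or_ge x.val (m + n - 1) with h' | h'
    · rcases h.eq_or_lt with h | h
      · exact ⟨⟨m - 2, by omega⟩, ⟨1, by omega⟩, by grind⟩
      · exact ⟨⟨m - 1, by omega⟩, ⟨x.val - (m - 1), by omega⟩, by grind⟩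
    · exact ⟨⟨m - 1, by omega⟩, ⟨0, by omega⟩, by grind⟩
  · intro i
    suffices h : ∃ k : ℕ, ∀ j : Fin n, ∃ l < n, a i j = k + l by
      obtain ⟨k, hk⟩ := h
      refine ⟨k, fun j => ?_⟩
      obtain ⟨l, hl, h⟩ := hk j
      exact ⟨l, hl, by simp [h]⟩
    by_cases hi : (i : ℕ) = m - 1
    · refine ⟨m, fun j => ?_⟩
      by_cases hj : (j : ℕ) = 0
      · exact ⟨n - 1, by omega, by grind⟩
      · exact ⟨j - 1, by omega, by grind⟩
    · exact ⟨i, fun j => ⟨j, j.2, by grind⟩⟩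
  · intro j
    by_cases hj : (j : ℕ) = 0
    · refine ⟨((m + n - 1 : ℕ) : ZMod (m + n)), fun i => ?_⟩
      by_cases hi : (i : ℕ) = m - 1
      · exact ⟨0, by omega, by simp [a, hi, hj]⟩
      · refine ⟨i + 1, by omega, ?_⟩
        rw [← Nat.cast_add, show m + n - 1 + (i + 1) = m + n + a i j by grind, Nat.cast_add,
          ZMod.natCast_self, zero_add]
    · exact ⟨(j : ℕ), fun i => ⟨i, i.2, by simp [a, hj, add_comm]⟩⟩

lemma wc_completeBipartiteGraph {m n : ℕ} (hm : 0 < m) (hn : 0 < n) :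
    wc (completeBipartiteGraph (Fin m) (Fin n)) = max m n :=
  IsLeast.csInf_eq ⟨hasIntervalCyclicColoring_max hm hn, fun _ h => h.max_le hm hn⟩

/-- For the complete bipartite graph `K_{m,n}`: if `min{m,n} = 1`,
then `w_c(K_{m,n}) = W_c(K_{m,n}) = m + n − 1`; if `min{m,n} ≥ 2`, then
`w_c(K_{m,n}) = max{m,n}` and `W_c(K_{m,n}) ≥ m + n`. -/
theorem stmt_15 (m n : ℕ) :
    (min m n = 1 →
      wc (completeBipartiteGraph (Fin m) (Fin n)) = m + n - 1 ∧
      Wc (completeBipartiteGraph (Fin m) (Fin n)) = m + n - 1) ∧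
    (2 ≤ min m n →
      wc (completeBipartiteGraph (Fin m) (Fin n)) = max m n ∧
      m + n ≤ Wc (completeBipartiteGraph (Fin m) (Fin n))) := by
  constructor
  · intro h
    have hm : 0 < m := by omega
    have hn : 0 < n := by omega
    have hmax : max m n = m + n - 1 := by omega
    have hmul : m * n = m + n - 1 := by
      rcases min_choice m n with h' | h'
      · obtain rfl : m = 1 := by omega
        omega
      · obtain rfl : n = 1 := by omega
        omega
    refine ⟨(wc_completeBipartiteGraph hm hn).trans hmax, IsGreatest.csSup_eq ⟨?_, ?_⟩⟩
    · exact hmax ▸ hasIntervalCyclicColoring_max hm hn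
    · exact fun t ht => hmul ▸ HasIntervalCyclicColoring.le_mul ht
  · intro h
    have hm : 2 ≤ m := by omega
    have hn : 2 ≤ n := by omega
    exact ⟨wc_completeBipartiteGraph (by omega) (by omega),
      le_csSup ⟨m * n, fun t ht => HasIntervalCyclicColoring.le_mul ht⟩
        (hasIntervalCyclicColoring_add hm hn)⟩

end IntervalCyclic
end

section
/- For all positive integers l, m, n, the complete tripartite graph K_{l,m,n} admits an interval cyclic (l+m+n)-coloring; consequently K_{l,m,n} ∈ N_c, w_c(K_{l,m,n}) ≤ l + m + n, and W_c(K_{l,m,n}) ≥ l + m + n. -/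
attribute [local instance] Classical.propDecidable

namespace IntervalCyclic

variable {V : Type*}

/-- The complete tripartite graph with parts of sizes `l`, `m`, `n`: two vertices
are adjacent if and only if they lie in different parts. -/
def completeTripartiteGraph (l m n : ℕ) : SimpleGraph (Fin l ⊕ Fin m ⊕ Fin n) :=
  SimpleGraph.comap
    (Sum.elim (fun _ => (0 : Fin 3)) (Sum.elim (fun _ => 1) (fun _ => 2))) ⊤

/-- The position of a vertex when the three parts are listed one after the other. -/
def position (l m n : ℕ) : Fin l ⊕ Fin m ⊕ Fin n → ℕ :=
  Sum.elim (fun a => a) (Sum.elim (fun b => l + b) (fun c => l + m + c))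

lemma position_lt (l m n : ℕ) (v : Fin l ⊕ Fin m ⊕ Fin n) :
    position l m n v < l + m + n := by
  rcases v with a | b | c <;> simp only [position, Sum.elim_inl, Sum.elim_inr] <;> omega

lemma position_injective (l m n : ℕ) : Function.Injective (position l m n) := by
  rintro (a | b | c) (a' | b' | c') h <;>
    simp only [position, Sum.elim_inl, Sum.elim_inr] at h <;>
    simp only [Sum.inl.injEq, Sum.inr.injEq, reduceCtorEq, Fin.ext_iff] <;> omega

/-- The edge-coloring that adds the positions of the two endpoints modulo `l + m + n`. -/
def positionColoring (l m n : ℕ) : Sym2 (Fin l ⊕ Fin m ⊕ Fin n) → ZMod (l + m + n) :=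
  Sym2.lift ⟨fun u v => ((position l m n u + position l m n v : ℕ) : ZMod (l + m + n)),
    fun u v => by simp only [Nat.add_comm]⟩

lemma positionColoring_mk (l m n : ℕ) (u v : Fin l ⊕ Fin m ⊕ Fin n) :
    positionColoring l m n s(u, v) =
      ((position l m n u + position l m n v : ℕ) : ZMod (l + m + n)) := rfl

/-- If the neighbors of `v` are enumerated by `q` as `0, …, d - 1` and the edge to the
neighbor `w` has color `k + q w`, then the colors at `v` are `deg v` consecutive ones. -/
lemma image_color_eq_of_enumeration [Fintype V] (G : SimpleGraph V) {t : ℕ}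
    (c : Sym2 V → ZMod t) (v : V) (k : ZMod t) (q : V → ℕ) (d : ℕ)
    (hc : ∀ w, G.Adj v w → c s(v, w) = k + (q w : ZMod t))
    (hinj : ∀ w w', G.Adj v w → G.Adj v w' → q w = q w' → w = w')
    (hrange : ∀ i, i < d ↔ ∃ w, G.Adj v w ∧ q w = i) :
    (G.neighborFinset v).image (fun w => c s(v, w)) =
      (Finset.range (G.degree v)).image (fun i => k + (i : ZMod t)) := by
  have himage : (G.neighborFinset v).image q = Finset.range d := by
    ext i
    simp [hrange]
  have hdeg : G.degree v = d := by
    rw [← Finset.card_range d, ← himage, Finset.card_image_of_injOn,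
      SimpleGraph.card_neighborFinset_eq_degree]
    intro w hw w' hw' h
    exact hinj w w' (by simpa using hw) (by simpa using hw') h
  rw [hdeg, ← himage]
  ext x
  simp only [Finset.bind_def, Finset.pure_def, Finset.mem_image, Finset.mem_sup,
    Finset.mem_singleton, SimpleGraph.mem_neighborFinset]
  constructor
  · rintro ⟨w, hw, rfl⟩
    exact ⟨_, ⟨_, ⟨w, hw, rfl⟩, rfl⟩, (hc w hw).symm⟩
  · rintro ⟨_, ⟨_, ⟨w, hw, rfl⟩, rfl⟩, rfl⟩
    exact ⟨w, hw, hc w hw⟩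

lemma exists_image_positionColoring_eq (l m n : ℕ) (v : Fin l ⊕ Fin m ⊕ Fin n) :
    ∃ k : ZMod (l + m + n),
      ((completeTripartiteGraph l m n).neighborFinset v).image
          (fun w => positionColoring l m n s(v, w)) =
        (Finset.range ((completeTripartiteGraph l m n).degree v)).image
          (fun i => k + (i : ZMod (l + m + n))) := by
  have hzero : (l : ZMod (l + m + n)) + m + n = 0 := by
    exact_mod_cast ZMod.natCast_self (l + m + n)
  rcases v with v | v | v
  · refine ⟨_, image_color_eq_of_enumeration _ _ _ ((v + l : ℕ) : ZMod (l + m + n))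
      (Sum.elim (fun _ => 0) (Sum.elim (fun b => b) (fun c => m + c))) (m + n) ?_ ?_ ?_⟩
    · rintro (w | w | w) h <;> simp [completeTripartiteGraph] at h <;>
        simp [positionColoring_mk, position] <;> ring
    · rintro (w | w | w) (w' | w' | w') h h' hq <;>
        simp [completeTripartiteGraph] at h h' hq <;> simp [Fin.ext_iff] <;> omega
    · intro i
      constructor
      · intro hi
        by_cases him : i < m
        · exact ⟨.inr (.inl ⟨i, him⟩), by simp [completeTripartiteGraph]⟩
        · exact ⟨.inr (.inr ⟨i - m, by omega⟩), by simp [completeTripartiteGraph]; omega⟩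
      · rintro ⟨w | w | w, h, hq⟩ <;> simp [completeTripartiteGraph] at h hq <;> omega
  · refine ⟨_, image_color_eq_of_enumeration _ _ _ ((l + v + l + m : ℕ) : ZMod (l + m + n))
      (Sum.elim (fun a => n + a) (Sum.elim (fun _ => 0) (fun c => c))) (l + n) ?_ ?_ ?_⟩
    · rintro (w | w | w) h <;> simp [completeTripartiteGraph] at h <;>
        simp [positionColoring_mk, position] <;> grind
    · rintro (w | w | w) (w' | w' | w') h h' hq <;>
        simp [completeTripartiteGraph] at h h' hq <;> simp [Fin.ext_iff] <;> omega
    · intro i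
      constructor
      · intro hi
        by_cases hin : i < n
        · exact ⟨.inr (.inr ⟨i, hin⟩), by simp [completeTripartiteGraph]⟩
        · exact ⟨.inl ⟨i - n, by omega⟩, by simp [completeTripartiteGraph]; omega⟩
      · rintro ⟨w | w | w, h, hq⟩ <;> simp [completeTripartiteGraph] at h hq <;> omega
  · refine ⟨_, image_color_eq_of_enumeration _ _ _ ((l + m + v : ℕ) : ZMod (l + m + n))
      (Sum.elim (fun a => a) (Sum.elim (fun b => l + b) (fun _ => 0))) (l + m) ?_ ?_ ?_⟩
    · rintro (w | w | w) h <;> simp [completeTripartiteGraph] at h <;>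
        simp [positionColoring_mk, position]
    · rintro (w | w | w) (w' | w' | w') h h' hq <;>
        simp [completeTripartiteGraph] at h h' hq <;> simp [Fin.ext_iff] <;> omega
    · intro i
      constructor
      · intro hi
        by_cases hil : i < l
        · exact ⟨.inl ⟨i, hil⟩, by simp [completeTripartiteGraph]⟩
        · exact ⟨.inr (.inl ⟨i - l, by omega⟩), by simp [completeTripartiteGraph]; omega⟩
      · rintro ⟨w | w | w, h, hq⟩ <;> simp [completeTripartiteGraph] at h hq <;> omega

lemma exists_adj_position_add_eq (l m n : ℕ) (hl : 0 < l) (hm : 0 < m) (hn : 0 < n)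
    (r : ℕ) (hr : r < l + m + n) :
    ∃ u v, (completeTripartiteGraph l m n).Adj u v ∧
      position l m n u + position l m n v = l + r := by
  by_cases h₁ : r < m
  · exact ⟨.inl ⟨0, hl⟩, .inr (.inl ⟨r, h₁⟩), by simp [completeTripartiteGraph],
      by simp [position]⟩
  by_cases h₂ : r < m + n
  · exact ⟨.inl ⟨0, hl⟩, .inr (.inr ⟨r - m, by omega⟩), by simp [completeTripartiteGraph],
      by simp [position]; omega⟩
  by_cases h₃ : r < l + m + n - 1
  · exact ⟨.inl ⟨r - (m + n - 1), by omega⟩, .inr (.inr ⟨n - 1, by omega⟩),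
      by simp [completeTripartiteGraph], by simp [position]; omega⟩
  · exact ⟨.inr (.inl ⟨0, hm⟩), .inr (.inr ⟨n - 1, by omega⟩),
      by simp [completeTripartiteGraph], by simp [position]; omega⟩

lemma isIntervalCyclicColoring_positionColoring (l m n : ℕ)
    (hl : 0 < l) (hm : 0 < m) (hn : 0 < n) :
    IsIntervalCyclicColoring (completeTripartiteGraph l m n) (l + m + n)
      (positionColoring l m n) := by
  refine ⟨?_, ?_, exists_image_positionColoring_eq l m n⟩
  · intro v w w' _ _ hne h
    simp only [positionColoring_mk, Nat.cast_add, add_right_inj] at h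
    rw [ZMod.natCast_eq_natCast_iff', Nat.mod_eq_of_lt (position_lt ..),
      Nat.mod_eq_of_lt (position_lt ..)] at h
    exact hne (position_injective l m n h)
  · intro x
    have : NeZero (l + m + n) := ⟨by omega⟩
    obtain ⟨u, v, hadj, h⟩ := exists_adj_position_add_eq l m n hl hm hn
      (x - (l : ZMod (l + m + n))).val (ZMod.val_lt _)
    refine ⟨s(u, v), hadj, ?_⟩
    rw [positionColoring_mk, h, Nat.cast_add, ZMod.natCast_zmod_val]
    ring

lemma HasIntervalCyclicColoring.le_ncard_edgeSet [Fintype V] {G : SimpleGraph V} {t : ℕ}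
    (h : HasIntervalCyclicColoring G t) : t ≤ G.edgeSet.ncard := by
  obtain ⟨_, c, _, hsurj, _⟩ := h
  have himage : c '' G.edgeSet = Set.univ := Set.eq_univ_of_forall hsurj
  calc t = (c '' G.edgeSet).ncard := by rw [himage, Set.ncard_univ, Nat.card_zmod]
    _ ≤ G.edgeSet.ncard := Set.ncard_image_le

/-- For all positive integers `l, m, n`, the complete tripartite
graph `K_{l,m,n}` admits an interval cyclic `(l+m+n)`-coloring; consequently
`K_{l,m,n} ∈ N_c`, `w_c(K_{l,m,n}) ≤ l + m + n`, and `W_c(K_{l,m,n}) ≥ l + m + n`. -/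
theorem stmt_16 (l m n : ℕ) (hl : 0 < l) (hm : 0 < m) (hn : 0 < n) :
    HasIntervalCyclicColoring (completeTripartiteGraph l m n) (l + m + n) ∧
      (∃ t, HasIntervalCyclicColoring (completeTripartiteGraph l m n) t) ∧
      wc (completeTripartiteGraph l m n) ≤ l + m + n ∧
      l + m + n ≤ Wc (completeTripartiteGraph l m n) := by
  have h : HasIntervalCyclicColoring (completeTripartiteGraph l m n) (l + m + n) :=
    ⟨by omega, _, isIntervalCyclicColoring_positionColoring l m n hl hm hn⟩
  exact ⟨h, ⟨_, h⟩, Nat.sInf_le h, le_csSup ⟨_, fun _ ht => ht.le_ncard_edgeSet⟩ h⟩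

end IntervalCyclic
end

section
/- Let T be a finite tree with at least two vertices, let L(T) be the set of its pendant (degree-one) vertices, and for vertices v_i, v_j let LP(v_i, v_j) = |EP(v_i, v_j)| + |{vw ∈ E(T) : v ∈ VP(v_i, v_j), w ∉ VP(v_i, v_j)}|, where VP(v_i,v_j) and EP(v_i,v_j) are the vertex and edge sets of the unique path in T joining v_i and v_j; set M(T) = max over all pairs v_i ≠ v_j of LP(v_i, v_j). Let T̃ be the graph obtained from T by adding a new vertex u adjacent to every vertex of L(T). If |L(T)| ≥ 2(M(T) + 2), then T̃ has no interval cyclic t-coloring for any positive integer t, i.e., T̃ ∉ N_c. -/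
attribute [local instance] Classical.propDecidable

namespace IntervalCyclic

variable {V : Type*}

/-- `LP(v_i, v_j)` for the path `p` joining `v_i` and `v_j` in the tree `T`:
the number of edges of the path plus the number of edges of `T` with exactly one
endpoint on the path. -/
noncomputable def LP [Fintype V] (T : SimpleGraph V) {u v : V} (p : T.Walk u v) : ℕ :=
  p.length + (T.edgeFinset.filter fun e =>
    ∃ a b : V, e = s(a, b) ∧ a ∈ p.support ∧ b ∉ p.support).card

/-- `M(T)`: the maximum of `LP(v_i, v_j)` over all pairs of distinct vertices
`v_i ≠ v_j` (each pair being joined by a unique path since `T` is a tree). -/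
noncomputable def M [Fintype V] (T : SimpleGraph V) : ℕ :=
  sSup {s : ℕ | ∃ (u v : V) (p : T.Walk u v), u ≠ v ∧ p.IsPath ∧ s = LP T p}

/-- The graph `T̃` obtained from `T` by adding a new vertex `u` adjacent to every
pendant (degree-one) vertex of `T`. -/
def Ttilde [Fintype V] (T : SimpleGraph V) : SimpleGraph (V ⊕ Unit) :=
  SimpleGraph.fromRel (fun x y =>
    match x, y with
    | Sum.inl a, Sum.inl b => T.Adj a b
    | Sum.inl a, Sum.inr _ => T.degree a = 1
    | Sum.inr _, _ => False)

/-- `x` and `y` are at cyclic distance at most `n` in `ZMod t`. -/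
def CyclicallyWithin {t : ℕ} (n : ℕ) (x y : ZMod t) : Prop :=
  ∃ m : ℤ, |m| ≤ n ∧ y - x = (m : ZMod t)

theorem CyclicallyWithin.trans {t n m : ℕ} {x y z : ZMod t} (hxy : CyclicallyWithin n x y)
    (hyz : CyclicallyWithin m y z) : CyclicallyWithin (n + m) x z := by
  obtain ⟨a, ha, ha'⟩ := hxy
  obtain ⟨b, hb, hb'⟩ := hyz
  refine ⟨a + b, (abs_add_le a b).trans (by push_cast; omega), ?_⟩
  push_cast
  rw [← ha', ← hb']
  ring

theorem CyclicallyWithin.mono {t n m : ℕ} {x y : ZMod t} (hnm : n ≤ m)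
    (h : CyclicallyWithin n x y) : CyclicallyWithin m x y := by
  obtain ⟨a, ha, ha'⟩ := h
  exact ⟨a, ha.trans (by exact_mod_cast hnm), ha'⟩

theorem not_cyclicallyWithin_add {t n : ℕ} (ht : 2 * n + 2 ≤ t) (x : ZMod t) :
    ¬ CyclicallyWithin n x (x + ((n + 1 : ℕ) : ZMod t)) := by
  rintro ⟨m, hm, h⟩
  have hzero : (((n + 1 : ℕ) - m : ℤ) : ZMod t) = 0 := by
    push_cast at h ⊢
    rw [← h]
    ring
  rw [(CharP.intCast_eq_zero_iff (ZMod t) t)] at hzero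
  rw [abs_le] at hm
  have := Int.le_of_dvd (by push_cast; omega) hzero
  push_cast at this
  omega

section Coloring

variable [Fintype V] {G : SimpleGraph V} {t : ℕ} {c : Sym2 V → ZMod t}

theorem IsIntervalCyclicColoring.cyclicallyWithin_degree (hc : IsIntervalCyclicColoring G t c)
    {v x y : V} (hx : G.Adj v x) (hy : G.Adj v y) :
    CyclicallyWithin (G.degree v - 1) (c s(v, x)) (c s(v, y)) := by
  obtain ⟨k, hk⟩ := hc.2.2 v
  have color : ∀ w, G.Adj v w → ∃ i < G.degree v, k + (i : ZMod t) = c s(v, w) := by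
    intro w hw
    have : c s(v, w) ∈ (G.neighborFinset v).image (fun w => c s(v, w)) :=
      Finset.mem_image_of_mem _ ((G.mem_neighborFinset v w).2 hw)
    rw [hk] at this
    simpa [eq_neg_add_iff_add_eq] using this
  obtain ⟨i, hi, hix⟩ := color x hx
  obtain ⟨j, hj, hjy⟩ := color y hy
  refine ⟨(j : ℤ) - i, abs_le.2 ⟨by omega, by omega⟩, ?_⟩
  rw [← hix, ← hjy]
  push_cast
  ring

theorem IsIntervalCyclicColoring.cyclicallyWithin_walk (hc : IsIntervalCyclicColoring G t c)
    {v w : V} (p : G.Walk v w) {x y : V} (hx : G.Adj v x) (hy : G.Adj w y) :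
    CyclicallyWithin (p.support.map fun z => G.degree z - 1).sum (c s(v, x)) (c s(w, y)) := by
  induction p generalizing x with
  | nil => simpa using hc.cyclicallyWithin_degree hx hy
  | @cons a b _ h p ih =>
    have hstep := ih (x := a) h.symm hy
    rw [Sym2.eq_swap] at hstep
    simpa using (hc.cyclicallyWithin_degree hx h).trans hstep

theorem IsIntervalCyclicColoring.degree_le (ht : 0 < t) (hc : IsIntervalCyclicColoring G t c)
    (v : V) : G.degree v ≤ t := by
  have : NeZero t := ⟨ht.ne'⟩
  rw [← G.card_neighborFinset_eq_degree v, ← ZMod.card t, ← Finset.card_univ]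
  refine Finset.card_le_card_of_injOn (fun w => c s(v, w)) (by simp) ?_
  intro x hx y hy hxy
  by_contra hne
  exact hc.1 v x y (by simpa using hx) (by simpa using hy) hne hxy

end Coloring

section Tree

variable {T : SimpleGraph V} {a b : V}

theorem mem_edges_of_adj_of_mem_support (hacyc : T.IsAcyclic) (p : T.Walk a b) {x y : V}
    (hx : x ∈ p.support) (hy : y ∈ p.support) (hxy : T.Adj x y) : s(x, y) ∈ p.edges := by
  have hbridge := SimpleGraph.isBridge_iff_forall_walk_mem_edges.1
    (SimpleGraph.isAcyclic_iff_forall_adj_isBridge.1 hacyc hxy)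
  have := hbridge ((p.takeUntil x hx).reverse.append (p.takeUntil y hy))
  rw [SimpleGraph.Walk.edges_append, SimpleGraph.Walk.edges_reverse, List.mem_append,
    List.mem_reverse] at this
  exact this.elim (fun h => p.edges_takeUntil_subset_edges hx h)
    (fun h => p.edges_takeUntil_subset_edges hy h)

variable [Fintype V]

theorem eq_start_or_eq_end_of_degree_eq_one {p : T.Walk a b} (hp : p.IsPath) {v : V}
    (hv : v ∈ p.support) (hdeg : T.degree v = 1) : v = a ∨ v = b := by
  obtain ⟨i, rfl, hi⟩ := SimpleGraph.Walk.mem_support_iff_exists_getVert.1 hv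
  rcases Nat.eq_zero_or_pos i with rfl | hpos
  · simp
  rcases hi.eq_or_lt with rfl | hlt
  · simp
  obtain ⟨j, rfl⟩ := Nat.exists_eq_succ_of_ne_zero hpos.ne'
  have hprev := (p.adj_getVert_succ (i := j) (by omega)).symm
  have hnext := p.adj_getVert_succ hlt
  have heq := (SimpleGraph.degree_eq_one_iff_existsUnique_adj.1 hdeg).unique hprev hnext
  have := hp.getVert_injOn (by simp; omega) (by simp; omega) heq
  omega

theorem sum_degree_support_le (hacyc : T.IsAcyclic) {p : T.Walk a b} (hp : p.IsPath) :
    ∑ v ∈ p.support.toFinset, T.degree v ≤ p.length + LP T p := by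
  have hlen : (T.edgeFinset.filter (· ∈ p.edges)).card ≤ p.length := by
    rw [← p.length_edges, ← List.toFinset_card_of_nodup hp.isTrail.edges_nodup]
    exact Finset.card_le_card fun e he => by simpa using (Finset.mem_filter.1 he).2
  have hsum : ∑ v ∈ p.support.toFinset, T.degree v =
      ∑ e ∈ T.edgeFinset, (p.support.toFinset.filter (· ∈ e)).card := by
    simp_rw [← T.card_incidenceFinset_eq_degree, T.incidenceFinset_eq_filter]
    exact Finset.sum_card_bipartiteAbove_eq_sum_card_bipartiteBelow _
  have hedge : ∀ e ∈ T.edgeFinset, (p.support.toFinset.filter (· ∈ e)).card ≤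
      2 * (if e ∈ p.edges then 1 else 0) +
        (if ∃ a b : V, e = s(a, b) ∧ a ∈ p.support ∧ b ∉ p.support then 1 else 0) := by
    intro e he
    induction e using Sym2.ind with
    | _ x y =>
    have hadj : T.Adj x y := by simpa using he
    by_cases hmem : s(x, y) ∈ p.edges
    · have : (p.support.toFinset.filter (· ∈ s(x, y))).card ≤ ({x, y} : Finset V).card :=
        Finset.card_le_card fun z hz => by simpa using (Finset.mem_filter.1 hz).2
      have := this.trans Finset.card_le_two
      rw [if_pos hmem]
      omega
    · by_cases hx : x ∈ p.support
      · have hy : y ∉ p.support := fun hy =>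
          hmem (mem_edges_of_adj_of_mem_support hacyc p hx hy hadj)
        rw [if_neg hmem, if_pos ⟨x, y, rfl, hx, hy⟩]
        refine (Finset.card_le_card (t := {x}) fun z hz => ?_).trans (by simp)
        aesop
      · by_cases hy : y ∈ p.support
        · rw [if_neg hmem, if_pos ⟨y, x, Sym2.eq_swap, hy, hx⟩]
          refine (Finset.card_le_card (t := {y}) fun z hz => ?_).trans (by simp)
          aesop
        · refine (Finset.card_le_card (t := ∅) fun z hz => ?_).trans (by simp)
          aesop
  have := Finset.sum_le_sum hedge
  rw [← hsum, Finset.sum_add_distrib, ← Finset.mul_sum, ← Finset.card_filter,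
    ← Finset.card_filter] at this
  unfold LP
  omega

theorem LP_le_M {p : T.Walk a b} (hab : a ≠ b) (hp : p.IsPath) : LP T p ≤ M T := by
  refine le_csSup ⟨Fintype.card V + T.edgeFinset.card, ?_⟩ ⟨a, b, p, hab, hp, rfl⟩
  rintro _ ⟨x, y, q, -, hq, rfl⟩
  exact Nat.add_le_add hq.length_lt.le (Finset.card_filter_le _ _)

@[simp]
theorem ttilde_adj_inl_inl {x y : V} :
    (Ttilde T).Adj (Sum.inl x) (Sum.inl y) ↔ T.Adj x y := by
  simp only [Ttilde, SimpleGraph.fromRel_adj, ne_eq, Sum.inl.injEq, T.adj_comm y x, or_self]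
  exact and_iff_right_of_imp fun h => h.ne

@[simp]
theorem ttilde_adj_inl_inr {x : V} {i : Unit} :
    (Ttilde T).Adj (Sum.inl x) (Sum.inr i) ↔ T.degree x = 1 := by
  simp [Ttilde]

@[simp]
theorem ttilde_adj_inr_inl {x : V} {i : Unit} :
    (Ttilde T).Adj (Sum.inr i) (Sum.inl x) ↔ T.degree x = 1 := by
  simp [Ttilde]

/-- The inclusion of `T` into `T̃`. -/
def ttildeInl (T : SimpleGraph V) : T →g Ttilde T where
  toFun := Sum.inl
  map_rel' := ttilde_adj_inl_inl.2

theorem ttilde_degree_inl_le (v : V) :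
    (Ttilde T).degree (Sum.inl v) ≤ T.degree v + if T.degree v = 1 then 1 else 0 := by
  rw [← SimpleGraph.card_neighborFinset_eq_degree, ← T.card_neighborFinset_eq_degree v]
  have hsub : (Ttilde T).neighborFinset (Sum.inl v) ⊆
      (T.neighborFinset v).image Sum.inl ∪
        if T.degree v = 1 then {Sum.inr ()} else ∅ := by
    rintro (w | ⟨⟩) hw
    · simpa using Or.inl hw
    · have : T.degree v = 1 := by simpa using hw
      simp [this]
  refine (Finset.card_le_card hsub).trans ((Finset.card_union_le _ _).trans ?_)
  refine Nat.add_le_add Finset.card_image_le ?_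
  rw [T.card_neighborFinset_eq_degree v]
  split_ifs <;> simp

theorem ttilde_degree_inr :
    (Ttilde T).degree (Sum.inr ()) = (Finset.univ.filter fun v => T.degree v = 1).card := by
  rw [← SimpleGraph.card_neighborFinset_eq_degree,
    ← Finset.card_image_of_injective _ (Sum.inl_injective (α := V) (β := Unit))]
  congr 1
  ext (w | ⟨⟩) <;> simp

theorem sum_ttilde_degree_sub_one_le (hacyc : T.IsAcyclic) (hpos : ∀ v, 0 < T.degree v)
    {p : T.Walk a b} (hp : p.IsPath) :
    ((p.map (ttildeInl T)).support.map fun z => (Ttilde T).degree z - 1).sum ≤ LP T p + 1 := by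
  have hnodup := hp.support_nodup
  have hcard : p.support.toFinset.card = p.length + 1 := by
    rw [List.toFinset_card_of_nodup hnodup, p.length_support]
  have hleaf : (p.support.toFinset.filter fun v => T.degree v = 1).card ≤ 2 := by
    refine (Finset.card_le_card (t := {a, b}) fun v hv => ?_).trans Finset.card_le_two
    rw [Finset.mem_filter, List.mem_toFinset] at hv
    simpa using eq_start_or_eq_end_of_degree_eq_one hp hv.1 hv.2
  have hterm : ∀ v ∈ p.support.toFinset, ((Ttilde T).degree (Sum.inl v) - 1) + 1 ≤
      T.degree v + if T.degree v = 1 then 1 else 0 := by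
    intro v _
    have := ttilde_degree_inl_le (T := T) v
    have := hpos v
    omega
  have hsum := Finset.sum_le_sum hterm
  rw [Finset.sum_add_distrib, Finset.sum_add_distrib, ← Finset.card_filter,
    List.sum_toFinset _ hnodup] at hsum
  have hdeg := sum_degree_support_le hacyc hp
  simp only [Finset.sum_const, smul_eq_mul, mul_one, hcard] at hsum
  rw [SimpleGraph.Walk.support_map, List.map_map]
  change (p.support.map fun v => (Ttilde T).degree (Sum.inl v) - 1).sum ≤ _
  omega

end Tree

/-- Let `T` be a finite tree with at least two vertices, `L(T)`
its set of pendant vertices, and `M(T)` as above. If `|L(T)| ≥ 2(M(T) + 2)`, then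
`T̃` has no interval cyclic `t`-coloring for any positive integer `t`,
i.e. `T̃ ∉ N_c`. -/
theorem stmt_18 {V : Type*} [Fintype V] (T : SimpleGraph V)
    (hconn : T.Connected) (hacyc : T.IsAcyclic) (hcard : 2 ≤ Fintype.card V)
    (hL : 2 * (M T + 2) ≤ (Finset.univ.filter fun v => T.degree v = 1).card) :
    ∀ t : ℕ, ¬ HasIntervalCyclicColoring (Ttilde T) t := by
  rintro t ⟨ht, c, hc⟩
  have : Nontrivial V := Fintype.one_lt_card_iff_nontrivial.1 hcard
  have hpos : ∀ v, 0 < T.degree v := fun v => hconn.preconnected.degree_pos_of_nontrivial v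
  rw [← ttilde_degree_inr] at hL
  have htL := hc.degree_le ht (Sum.inr ())
  obtain ⟨k, hk⟩ := hc.2.2 (Sum.inr ())
  have leaf : ∀ i < (Ttilde T).degree (Sum.inr ()), ∃ v, T.degree v = 1 ∧
      c s(Sum.inl v, Sum.inr ()) = k + (i : ZMod t) := by
    intro i hi
    have hmem : k + (i : ZMod t) ∈ (Finset.range ((Ttilde T).degree (Sum.inr ()))).image
        (fun i => k + (i : ZMod t)) := by
      simpa using ⟨i, hi, rfl⟩
    rw [← hk, Finset.mem_image] at hmem
    obtain ⟨v | ⟨⟩, hv, hcv⟩ := hmem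
    · exact ⟨v, by simpa using hv, by rw [Sym2.eq_swap]; exact hcv⟩
    · simp at hv
  obtain ⟨a, ha, hca⟩ := leaf 0 (by omega)
  obtain ⟨b, hb, hcb⟩ := leaf (M T + 1 + 1) (by omega)
  rw [Nat.cast_zero, add_zero] at hca
  have hfar := not_cyclicallyWithin_add (n := M T + 1) (by omega) k
  rw [← hcb, ← hca] at hfar
  have hab : a ≠ b := by
    rintro rfl
    exact hfar ⟨0, by simp; omega, by simp⟩
  obtain ⟨p, hp⟩ := (hconn.preconnected a b).exists_isPath
  exact hfar <| (hc.cyclicallyWithin_walk (p.map (ttildeInl T))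
    (ttilde_adj_inl_inr.2 ha) (ttilde_adj_inl_inr.2 hb)).mono <|
    (sum_ttilde_degree_sub_one_le hacyc hpos hp).trans (Nat.succ_le_succ (LP_le_M hab hp))

end IntervalCyclic
end

section
/- For positive integers m, n, let K_{2n+1}^{*m} be the graph obtained from the complete graph on vertices v_1, …, v_{2n+1} by adding new vertices u, w_1, …, w_m together with the edge v_1u and the edges uw_i for 1 ≤ i ≤ m. If n ≥ 2 and m ≥ 6n, then K_{2n+1}^{*m} has no interval cyclic t-coloring for any positive integer t, i.e., K_{2n+1}^{*m} ∉ N_c. -/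
attribute [local instance] Classical.propDecidable

namespace IntervalCyclic

variable {V : Type*}

/-- The graph `K_{2n+1}^{*m}`: the complete graph on the `2n+1` vertices
`Sum.inl a` (`a : Fin (2n+1)`), together with a new vertex `u = Sum.inr (Sum.inl ())`
joined to the vertex `v_1 = Sum.inl 0`, and `m` new pendant vertices
`w_i = Sum.inr (Sum.inr i)` each joined to `u`. -/
def Kstar (n m : ℕ) : SimpleGraph (Fin (2 * n + 1) ⊕ Unit ⊕ Fin m) :=
  SimpleGraph.fromRel (fun x y =>
    match x, y with
    | Sum.inl a, Sum.inl b => a ≠ b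
    | Sum.inl a, Sum.inr (Sum.inl _) => a = 0
    | Sum.inr (Sum.inl _), Sum.inr (Sum.inr _) => True
    | _, _ => False)

theorem Kstar_adj_inl_inl {n m : ℕ} {a b : Fin (2 * n + 1)} :
    (Kstar n m).Adj (Sum.inl a) (Sum.inl b) ↔ a ≠ b := by
  simp only [Kstar, SimpleGraph.fromRel_adj, ne_eq, Sum.inl.injEq]
  tauto

theorem Kstar_adj_inl_hub {n m : ℕ} {a : Fin (2 * n + 1)} :
    (Kstar n m).Adj (Sum.inl a) (Sum.inr (Sum.inl ())) ↔ a = 0 := by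
  simp [Kstar]

theorem Kstar_not_adj_inl_leaf {n m : ℕ} {a : Fin (2 * n + 1)} {i : Fin m} :
    ¬ (Kstar n m).Adj (Sum.inl a) (Sum.inr (Sum.inr i)) := by
  simp [Kstar]

theorem Kstar_adj_hub_leaf {n m : ℕ} {i : Fin m} :
    (Kstar n m).Adj (Sum.inr (Sum.inl ())) (Sum.inr (Sum.inr i)) := by
  simp [Kstar]

theorem Kstar_degree_inl {n m : ℕ} {a : Fin (2 * n + 1)} (ha : a ≠ 0) :
    (Kstar n m).degree (Sum.inl a) = 2 * n := by
  have h : (Kstar n m).neighborFinset (Sum.inl a) =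
      (Finset.univ.erase a).map Function.Embedding.inl := by
    ext x
    rcases x with b | ⟨⟨⟩⟩ | i
    · simp [Kstar_adj_inl_inl, eq_comm]
    · simp [Kstar_adj_inl_hub, ha]
    · simp [Kstar_not_adj_inl_leaf]
  rw [← SimpleGraph.card_neighborFinset_eq_degree, h]
  simp

theorem Kstar_degree_inl_zero {n m : ℕ} :
    (Kstar n m).degree (Sum.inl 0) = 2 * n + 1 := by
  have h : (Kstar n m).neighborFinset (Sum.inl 0) =
      insert (Sum.inr (Sum.inl ())) ((Finset.univ.erase 0).map Function.Embedding.inl) := by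
    ext x
    rcases x with b | ⟨⟨⟩⟩ | i
    · simp [Kstar_adj_inl_inl, eq_comm]
    · simp [Kstar_adj_inl_hub]
    · simp [Kstar_not_adj_inl_leaf]
  rw [← SimpleGraph.card_neighborFinset_eq_degree, h, Finset.card_insert_of_notMem (by simp)]
  simp

/-- The colors at a vertex are exactly `degree`-many consecutive elements of `ZMod t`. -/
theorem IsIntervalCyclicColoring.exists_start [Fintype V] {G : SimpleGraph V} {t : ℕ}
    {c : Sym2 V → ZMod t} (hc : IsIntervalCyclicColoring G t c) (v : V) :
    ∃ k : ZMod t, (∀ w, G.Adj v w → ∃ i < G.degree v, c s(v, w) = k + (i : ZMod t)) ∧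
      ∀ i < G.degree v, ∃ w, G.Adj v w ∧ c s(v, w) = k + (i : ZMod t) := by
  obtain ⟨k, hk⟩ := hc.2.2 v
  replace hk : (G.neighborFinset v).image (fun w => c s(v, w)) =
      (Finset.range (G.degree v)).image (fun i : ℕ => k + (i : ZMod t)) := by
    rw [hk]
    ext x
    simp [eq_neg_add_iff_add_eq]
  refine ⟨k, fun w hw => ?_, fun i hi => ?_⟩
  · have h : c s(v, w) ∈ (G.neighborFinset v).image (fun w => c s(v, w)) :=
      Finset.mem_image_of_mem (fun w => c s(v, w)) ((G.mem_neighborFinset v w).2 hw)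
    rw [hk, Finset.mem_image] at h
    obtain ⟨i, hi, h⟩ := h
    exact ⟨i, Finset.mem_range.1 hi, h.symm⟩
  · have h : k + (i : ZMod t) ∈ (Finset.range (G.degree v)).image
        (fun i : ℕ => k + (i : ZMod t)) :=
      Finset.mem_image_of_mem (fun i : ℕ => k + (i : ZMod t)) (Finset.mem_range.2 hi)
    rw [← hk, Finset.mem_image] at h
    obtain ⟨w, hw, h⟩ := h
    exact ⟨w, (G.mem_neighborFinset v w).1 hw, h⟩

/-- A window of `d` consecutive naturals contains each residue modulo `d` exactly once. -/
theorem exists_add_mod_eq {d r : ℕ} (hr : r < d) (s : ℕ) :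
    ∃ i < d, (s + i) % d = r ∧ ∀ j < d, (s + j) % d = r → j = i := by
  have hd : 0 < d := by omega
  have hs := Nat.mod_lt s hd
  have key : s + (r + (d - s % d)) % d ≡ r [MOD d] := by
    have h : s + (r + (d - s % d)) % d ≡ s % d + (r + (d - s % d)) [MOD d] :=
      Nat.ModEq.add (Nat.mod_modEq s d).symm (Nat.mod_modEq _ d)
    rw [show s % d + (r + (d - s % d)) = r + d by omega] at h
    exact h.trans (Nat.add_mod_right r d)
  refine ⟨(r + (d - s % d)) % d, Nat.mod_lt _ hd, Nat.mod_eq_of_modEq key hr, fun j hj hjr => ?_⟩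
  have h : s + j ≡ s + (r + (d - s % d)) % d [MOD d] :=
    Nat.ModEq.trans (by simp [Nat.ModEq, hjr, Nat.mod_eq_of_lt hr]) key.symm
  exact Nat.ModEq.eq_of_lt_of_lt (Nat.ModEq.add_left_cancel' s h) hj (Nat.mod_lt _ hd)

/-- A symmetric irreflexive relation on a finite type of odd cardinality is not a perfect
matching. -/
theorem not_forall_existsUnique_of_odd_card {α : Type*} [Fintype α] (hα : Odd (Fintype.card α))
    {R : α → α → Prop} (hsymm : ∀ a b, R a b → R b a) (hirr : ∀ a, ¬ R a a) :
    ¬ ∀ a, ∃! b, R a b := by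
  intro h
  choose g hg hu using h
  have hsum : ∑ _a : α, (1 : ZMod 2) = 0 :=
    Finset.sum_involution (fun a _ => g a) (fun _ _ => by decide)
      (fun a _ _ he => hirr a (by simpa [he] using hg a)) (fun _ _ => Finset.mem_univ _)
      (fun a _ => (hu (g a) a (hsymm _ _ (hg a))).symm)
  rw [Finset.sum_const, Finset.card_univ, nsmul_one, ZMod.natCast_eq_zero_iff_even] at hsum
  exact Nat.not_even_iff_odd.2 hα hsum

theorem IsIntervalCyclicColoring.le_of_Kstar {n m t : ℕ} (ht : 0 < t)
    {c : Sym2 (Fin (2 * n + 1) ⊕ Unit ⊕ Fin m) → ZMod t}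
    (hc : IsIntervalCyclicColoring (Kstar n m) t c) : m ≤ t := by
  have : NeZero t := ⟨ht.ne'⟩
  have hinj : Function.Injective
      (fun i : Fin m => c s(Sum.inr (Sum.inl ()), Sum.inr (Sum.inr i))) := by
    intro i j hij
    by_contra hne
    exact hc.1 _ _ _ Kstar_adj_hub_leaf Kstar_adj_hub_leaf (by simpa using hne) hij
  simpa [ZMod.card] using Fintype.card_le_of_injective _ hinj

/-- If `n ≥ 2` and `m ≥ 6n`, then `K_{2n+1}^{*m}` has no interval
cyclic `t`-coloring for any positive integer `t`, i.e. `K_{2n+1}^{*m} ∉ N_c`. -/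
theorem stmt_19 (n m : ℕ) (hn : 2 ≤ n) (hm : 6 * n ≤ m) :
    ∀ t : ℕ, ¬ HasIntervalCyclicColoring (Kstar n m) t := by
  rintro t ⟨ht, c, hc⟩
  have hmt := hc.le_of_Kstar ht
  have : NeZero t := ⟨ht.ne'⟩
  obtain ⟨k, hk, hk'⟩ := hc.exists_start (Sum.inl 0)
  rw [Kstar_degree_inl_zero] at hk hk'
  let f : ZMod t → ℕ := fun x => (x - (k - ((2 * n : ℕ) : ZMod t))).val
  have hf : ∀ j ≤ 2 * n, f (k + (j : ZMod t)) = 2 * n + j := by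
    intro j hj
    have h : k + (j : ZMod t) - (k - ((2 * n : ℕ) : ZMod t)) = ((2 * n + j : ℕ) : ZMod t) := by
      push_cast; ring
    simp only [f]
    rw [h, ZMod.val_natCast_of_lt (by omega)]
  obtain ⟨p, hp, hpc⟩ := hk _ (Kstar_adj_inl_hub.2 rfl)
  obtain ⟨r, hr0, hr, hrp⟩ : ∃ r, 0 < r ∧ r < 2 * n ∧ r ≠ p := by
    by_cases h : p = 1
    · exact ⟨2, by omega, by omega, by omega⟩
    · exact ⟨1, by omega, by omega, by omega⟩
  refine not_forall_existsUnique_of_odd_card (α := Fin (2 * n + 1)) (by simp)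
    (R := fun a b => a ≠ b ∧ f (c s(Sum.inl a, Sum.inl b)) % (2 * n) = r)
    (fun a b h => ⟨h.1.symm, by rw [Sym2.eq_swap]; exact h.2⟩) (fun a h => h.1 rfl) fun a => ?_
  have huniq : ∀ {b b'}, a ≠ b → a ≠ b' →
      c s(Sum.inl a, Sum.inl b) = c s(Sum.inl a, Sum.inl b') → b = b' := by
    intro b b' hb hb' h
    by_contra hne
    exact hc.1 _ _ _ (Kstar_adj_inl_inl.2 hb) (Kstar_adj_inl_inl.2 hb') (by simpa using hne) h
  by_cases ha : a = 0
  · subst ha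
    obtain ⟨w, hw, hwc⟩ := hk' r (by omega)
    rcases w with b | ⟨⟨⟩⟩ | i
    · rw [Kstar_adj_inl_inl] at hw
      refine ⟨b, ⟨hw, ?_⟩, fun b' hb' => ?_⟩
      · rw [hwc, hf r (by omega), Nat.add_mod_left, Nat.mod_eq_of_lt hr]
      · obtain ⟨j, hj, hjc⟩ := hk _ (Kstar_adj_inl_inl.2 hb'.1)
        have hjr := hb'.2
        rw [hjc, hf j (by omega), Nat.add_mod_left] at hjr
        have hj' : j = r := by
          rcases Nat.lt_succ_iff_lt_or_eq.1 hj with h | h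
          · rwa [Nat.mod_eq_of_lt h] at hjr
          · rw [h, Nat.mod_self] at hjr
            omega
        exact huniq hb'.1 hw (by rw [hjc, hwc, hj'])
    · have h := congrArg f (hwc.symm.trans hpc)
      rw [hf r (by omega), hf p (by omega)] at h
      omega
    · exact absurd hw Kstar_not_adj_inl_leaf
  · obtain ⟨l, hl, hl'⟩ := hc.exists_start (Sum.inl a)
    rw [Kstar_degree_inl ha] at hl hl'
    obtain ⟨i, hi, hic⟩ := hl _ (Kstar_adj_inl_inl.2 ha)
    obtain ⟨j, hj, hjc⟩ := hk _ (Kstar_adj_inl_inl.2 (Ne.symm ha))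
    rw [Sym2.eq_swap, hic] at hjc
    obtain ⟨s, hs⟩ : ∃ s, s + i = 2 * n + j := ⟨2 * n + j - i, by omega⟩
    have hfl : ∀ x < 2 * n, f (l + (x : ZMod t)) = s + x := by
      intro x hx
      have hs' : (s : ZMod t) + i = ((2 * n : ℕ) : ZMod t) + j := by exact_mod_cast congrArg _ hs
      have h : l + (x : ZMod t) - (k - ((2 * n : ℕ) : ZMod t)) = ((s + x : ℕ) : ZMod t) := by
        push_cast at hs' ⊢
        linear_combination hjc - hs'
      simp only [f]
      rw [h, ZMod.val_natCast_of_lt (by omega)]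
    obtain ⟨x, hx, hxr, hxu⟩ := exists_add_mod_eq hr s
    obtain ⟨w, hw, hwc⟩ := hl' x hx
    rcases w with b | ⟨⟨⟩⟩ | i
    · rw [Kstar_adj_inl_inl] at hw
      refine ⟨b, ⟨hw, by rw [hwc, hfl x hx, hxr]⟩, fun b' hb' => ?_⟩
      obtain ⟨y, hy, hyc⟩ := hl _ (Kstar_adj_inl_inl.2 hb'.1)
      have hyr := hb'.2
      rw [hyc, hfl y hy] at hyr
      exact huniq hb'.1 hw (by rw [hyc, hwc, hxu y hy hyr])
    · exact absurd (Kstar_adj_inl_hub.1 hw) ha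
    · exact absurd hw Kstar_not_adj_inl_leaf

end IntervalCyclic
end
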